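/- Let n = 2m with m ≥ 2, let A be the adjacency matrix and D the distance matrix of the cycle graph C_n (viewed as complex n×n matrices), let s, t be real numbers, and for j ∈ {0,1,…,n−1} let v^{(j)} be the complex vector with k-th entry e^{2πijk/n} (k = 0,…,n−1). Then v^{(j)} is an eigenvector of sA + tD with eigenvalue: 2s + t·n²/4 if j = 0; 2s·cos(2πj/n) if j is even and j ≠ 0; and 2s·cos(2πj/n) − t·csc²(πj/n) if j is odd. -/

import Mathlib

open SimpleGraph

open scoped Fin.CommRing in
theorem SimpleGraph.cycleGraph_dist_add_natCast_le {n : ℕ} (u : Fin (n + 2)) (k : ℕ) :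
    (cycleGraph (n + 2)).dist u (u + (k : Fin (n + 2))) ≤ k := by
  induction k with
  | zero => simp
  | succ k ih =>
    have hadj : (cycleGraph (n + 2)).Adj (u + (k : Fin (n + 2)))
        (u + ((k + 1 : ℕ) : Fin (n + 2))) := by
      rw [cycleGraph_adj]
      right
      push_cast
      abel
    have htri : (cycleGraph (n + 2)).dist _ _ ≤ (cycleGraph (n + 2)).dist _ _ +
        (cycleGraph (n + 2)).dist _ _ := (cycleGraph_connected (n := n + 1)).dist_triangle
      (u := u) (v := u + (k : Fin (n + 2))) (w := u + ((k + 1 : ℕ) : Fin (n + 2)))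
    rw [dist_eq_one_iff_adj.mpr hadj] at htri
    omega

open scoped Fin.CommRing in
theorem SimpleGraph.cycleGraph_dist_le_val_sub {n : ℕ} (u v : Fin (n + 2)) :
    (cycleGraph (n + 2)).dist u v ≤ (v - u).val := by
  simpa using cycleGraph_dist_add_natCast_le u (v - u).val

theorem SimpleGraph.min_val_sub_le_length_of_cycleGraph_walk {n : ℕ} {u v : Fin n}
    (p : (cycleGraph n).Walk u v) : min (u - v).val (v - u).val ≤ p.length := by
  induction p with
  | nil => simp [Fin.sub_def]
  | @cons a b c h p ih =>
    rw [cycleGraph_adj'] at h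
    rw [Walk.length_cons]
    have key (x y : Fin n) : (y ≤ x ∧ (x - y).val = x.val - y.val) ∨
        (x < y ∧ (x - y).val = n + x.val - y.val) := by
      rcases le_or_gt y x with hxy | hxy
      · exact Or.inl ⟨hxy, Fin.coe_sub_iff_le.mpr hxy⟩
      · exact Or.inr ⟨hxy, Fin.coe_sub_iff_lt.mpr hxy⟩
    have := key a b
    have := key b a
    have := key a c
    have := key c a
    have := key b c
    have := key c b
    simp only [Fin.le_def, Fin.lt_def] at *
    omega

theorem SimpleGraph.cycleGraph_dist {n : ℕ} (u v : Fin n) :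
    (cycleGraph n).dist u v = min (u - v).val (v - u).val := by
  match n with
  | 0 => exact u.elim0
  | 1 => simp [Subsingleton.elim u v]
  | n + 2 =>
  apply le_antisymm
  · refine le_min ?_ (cycleGraph_dist_le_val_sub u v)
    rw [dist_comm]
    exact cycleGraph_dist_le_val_sub v u
  · obtain ⟨p, hp⟩ := (cycleGraph_connected (n := n + 1)).exists_walk_length_eq_dist u v
    exact hp ▸ min_val_sub_le_length_of_cycleGraph_walk p

/-- A circulant matrix has the geometric vector of any `n`-th root of unity as an eigenvector. -/
theorem Matrix.mulVec_pow_of_apply_eq_sub {R : Type*} [CommRing R] {n : ℕ} [NeZero n]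
    {M : Matrix (Fin n) (Fin n) R} {c : ℕ → R} (hM : ∀ u v, M u v = c (v - u).val)
    {ω : R} (hω : ω ^ n = 1) :
    M.mulVec (fun k => ω ^ k.val) = (∑ w ∈ Finset.range n, c w * ω ^ w) • fun k => ω ^ k.val := by
  ext u
  simp only [Matrix.mulVec, dotProduct, Pi.smul_apply, smul_eq_mul, hM]
  rw [← Equiv.sum_comp (Equiv.addLeft u), ← Fin.sum_univ_eq_sum_range (fun w => c w * ω ^ w),
    Finset.sum_mul]
  refine Finset.sum_congr rfl fun w _ => ?_
  have hpow : ω ^ (u + w).val = ω ^ u.val * ω ^ w.val := by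
    rw [Fin.val_add, ← pow_add, ← pow_eq_pow_mod _ hω]
  simp only [Equiv.coe_addLeft, add_sub_cancel_left, hpow]
  ring

theorem one_sub_sq_mul_sum_range_mul_pow {R : Type*} [CommRing R] (ω : R) (m : ℕ) :
    (1 - ω) ^ 2 * ∑ w ∈ Finset.range m, (w : R) * ω ^ w =
      ω - m * ω ^ m + (m - 1) * ω ^ (m + 1) := by
  induction m with
  | zero => simp
  | succ m ih =>
    rw [Finset.sum_range_succ, mul_add, ih]
    push_cast
    ring

theorem sum_range_min_mul_pow {R : Type*} [CommRing R] (ω : R) (m : ℕ) :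
    ∑ w ∈ Finset.range (2 * m), ((min w (2 * m - w) : ℕ) : R) * ω ^ w =
      (1 - ω ^ m) * ∑ w ∈ Finset.range m, (w : R) * ω ^ w +
        m * ω ^ m * ∑ w ∈ Finset.range m, ω ^ w := by
  rw [two_mul, Finset.sum_range_add, Finset.mul_sum, Finset.mul_sum, ← Finset.sum_add_distrib,
    ← Finset.sum_add_distrib]
  refine Finset.sum_congr rfl fun w hw => ?_
  have hwm : w < m := Finset.mem_range.mp hw
  rw [min_eq_left (by omega), min_eq_right (by omega),
    show m + m - (m + w) = m - w by omega, Nat.cast_sub hwm.le, pow_add]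
  ring

theorem sum_range_neighbors_mul_pow {R : Type*} [CommRing R] (ω : R) {n : ℕ} (hn : 3 ≤ n) :
    ∑ w ∈ Finset.range n, (if w = 1 ∨ w = n - 1 then (1 : R) else 0) * ω ^ w =
      ω + ω ^ (n - 1) := by
  have h (w : ℕ) : (if w = 1 ∨ w = n - 1 then (1 : R) else 0) * ω ^ w =
      (if w = 1 then ω ^ w else 0) + (if w = n - 1 then ω ^ w else 0) := by
    split_ifs <;> first | omega | simp
  rw [Finset.sum_congr rfl fun w _ => h w, Finset.sum_add_distrib, Finset.sum_ite_eq',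
    Finset.sum_ite_eq', if_pos (Finset.mem_range.mpr (by omega)),
    if_pos (Finset.mem_range.mpr (by omega)), pow_one]

theorem sum_range_min_mul_pow_of_pow_eq_one {R : Type*} [CommRing R] [IsDomain R] {ω : R} {m : ℕ}
    (hω : ω ^ m = 1) (h1 : ω ≠ 1) :
    ∑ w ∈ Finset.range (2 * m), ((min w (2 * m - w) : ℕ) : R) * ω ^ w = 0 := by
  have hgeom : ∑ w ∈ Finset.range m, ω ^ w = 0 := by
    have h := geom_sum_mul ω m
    rw [hω, sub_self] at h
    exact (mul_eq_zero.mp h).resolve_right (sub_ne_zero.mpr h1)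
  rw [sum_range_min_mul_pow, hω, hgeom]
  ring

theorem one_sub_sq_mul_sum_range_min_mul_pow_of_pow_eq_neg_one {R : Type*} [CommRing R] {ω : R}
    {m : ℕ} (hω : ω ^ m = -1) :
    (1 - ω) ^ 2 * ∑ w ∈ Finset.range (2 * m), ((min w (2 * m - w) : ℕ) : R) * ω ^ w = 4 * ω := by
  have hsum := one_sub_sq_mul_sum_range_mul_pow ω m
  have hgeom := geom_sum_mul ω m
  rw [pow_succ ω m, hω] at hsum
  rw [hω] at hgeom
  rw [sum_range_min_mul_pow, hω]
  linear_combination 2 * hsum + m * (1 - ω) * hgeom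

theorem sum_range_min_mul_one_pow {R : Type*} [CommRing R] (m : ℕ) :
    ∑ w ∈ Finset.range (2 * m), ((min w (2 * m - w) : ℕ) : R) * 1 ^ w = m ^ 2 := by
  rw [sum_range_min_mul_pow]
  simp [sq]

theorem Complex.one_sub_exp_sq (z : ℂ) :
    (1 - Complex.exp (2 * z * Complex.I)) ^ 2 =
      -4 * Complex.sin z ^ 2 * Complex.exp (2 * z * Complex.I) := by
  have hexp : Complex.exp (2 * z * Complex.I) = Complex.exp (z * Complex.I) ^ 2 := by
    rw [← Complex.exp_nat_mul]
    push_cast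
    ring_nf
  have hmul : Complex.exp (-z * Complex.I) * Complex.exp (z * Complex.I) = 1 := by
    rw [← Complex.exp_add]
    simp
  rw [hexp, Complex.sin]
  set a := Complex.exp (z * Complex.I)
  set b := Complex.exp (-z * Complex.I)
  linear_combination (-(b * a) - 1 + 2 * a ^ 2) * hmul + (b - a) ^ 2 * a ^ 2 * Complex.I_sq

/-- For the even cycle `C_n` with `n = 2m`, `m ≥ 2`, the vector
`v^{(j)}` with `k`-th entry `e^{2πijk/n}` is an eigenvector of `sA + tD` with the stated
eigenvalue, where `A` and `D` are the adjacency and distance matrices of `C_n` viewed as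
complex matrices. -/
theorem cycle_even_eigen (m : ℕ) (hm : 2 ≤ m) (s t : ℝ) (j : Fin (2 * m)) :
    let n : ℕ := 2 * m
    let G : SimpleGraph (Fin n) := SimpleGraph.cycleGraph n
    let A : Matrix (Fin n) (Fin n) ℂ := fun u v => if G.Adj u v then 1 else 0
    let D : Matrix (Fin n) (Fin n) ℂ := fun u v => (G.dist u v : ℂ)
    let v : Fin n → ℂ :=
      fun k => Complex.exp (2 * Real.pi * Complex.I * (j : ℕ) * (k : ℕ) / n)
    let lam : ℂ :=
      if (j : ℕ) = 0 then 2 * (s : ℂ) + (t : ℂ) * (n : ℂ) ^ 2 / 4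
      else if Even (j : ℕ) then
        2 * (s : ℂ) * (Real.cos (2 * Real.pi * (j : ℕ) / n) : ℂ)
      else
        2 * (s : ℂ) * (Real.cos (2 * Real.pi * (j : ℕ) / n) : ℂ) -
          (t : ℂ) * ((1 / Real.sin (Real.pi * (j : ℕ) / n) : ℝ) : ℂ) ^ 2
    v ≠ 0 ∧ ((s : ℂ) • A + (t : ℂ) • D).mulVec v = lam • v := by
  intro n G A D v lam
  have : NeZero n := ⟨by omega⟩
  have hn0 : (n : ℂ) ≠ 0 := Nat.cast_ne_zero.mpr (by omega)
  have hm0 : (m : ℂ) ≠ 0 := Nat.cast_ne_zero.mpr (by omega)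
  have hn : (n : ℂ) = 2 * (m : ℂ) := by simp [n]
  set z : ℂ := Real.pi * (j : ℕ) / n with hz
  set ω : ℂ := Complex.exp (2 * z * Complex.I) with hωdef
  have hωn : ω ^ n = 1 := by
    rw [hωdef, ← Complex.exp_nat_mul, Complex.exp_eq_one_iff]
    refine ⟨(j : ℕ), ?_⟩
    rw [hz]
    push_cast
    field_simp
  have hωm : ω ^ m = (-1) ^ (j : ℕ) := by
    rw [hωdef, ← Complex.exp_nat_mul, ← Complex.exp_pi_mul_I, ← Complex.exp_nat_mul]
    congr 1
    rw [hz, hn]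
    field_simp
  have hv : v = fun k => ω ^ k.val := by
    ext k
    rw [hωdef, ← Complex.exp_nat_mul]
    simp only [v]
    congr 1
    rw [hz]
    ring
  have hne : v ≠ 0 := fun h => Complex.exp_ne_zero _ (congrFun h j)
  refine ⟨hne, ?_⟩
  have hneg (u w : Fin n) : (u - w).val = if (w - u).val = 0 then 0 else n - (w - u).val := by
    rcases lt_trichotomy u w with h | rfl | h
    · rw [Fin.coe_sub_iff_lt.mpr h, Fin.coe_sub_iff_le.mpr h.le]
      have := Fin.lt_def.mp h
      split_ifs <;> omega
    · simp
    · rw [Fin.coe_sub_iff_lt.mpr h, Fin.coe_sub_iff_le.mpr h.le]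
      have := Fin.lt_def.mp h
      split_ifs <;> omega
  have hA (u w : Fin n) :
      A u w = if (w - u).val = 1 ∨ (w - u).val = n - 1 then 1 else 0 := by
    simp only [A, G]
    refine if_congr ?_ rfl rfl
    rw [cycleGraph_adj', hneg u w]
    have hlt := (w - u).isLt
    generalize (w - u).val = d at hlt ⊢
    grind
  have hD (u w : Fin n) :
      D u w = ((min (w - u).val (n - (w - u).val) : ℕ) : ℂ) := by
    simp only [D, G]
    congr 1
    refine (cycleGraph_dist u w).trans ?_
    rw [hneg u w]
    split_ifs with h
    · simp [h]
    · exact min_comm _ _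
  rw [Matrix.add_mulVec, Matrix.smul_mulVec, Matrix.smul_mulVec, hv,
    Matrix.mulVec_pow_of_apply_eq_sub (c := fun d => if d = 1 ∨ d = n - 1 then 1 else 0) hA hωn,
    Matrix.mulVec_pow_of_apply_eq_sub (c := fun d => ((min d (n - d) : ℕ) : ℂ)) hD hωn,
    smul_smul, smul_smul, ← add_smul]
  congr 1
  rw [sum_range_neighbors_mul_pow ω (by omega)]
  have hcos : ω + ω ^ (n - 1) = 2 * (Real.cos (2 * Real.pi * (j : ℕ) / n) : ℂ) := by
    have hinv : ω ^ (n - 1) = Complex.exp (-(2 * z) * Complex.I) := by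
      apply mul_right_cancel₀ (Complex.exp_ne_zero (2 * z * Complex.I))
      rw [← hωdef, ← pow_succ, Nat.sub_add_cancel (by omega), hωn, hωdef, ← Complex.exp_add]
      simp
    rw [hinv, hωdef, ← Complex.two_cos]
    push_cast
    rw [hz]
    ring_nf
  rw [hcos]
  have hsin_ne (hj : (j : ℕ) ≠ 0) : Complex.sin z ≠ 0 := by
    have hnR : (0 : ℝ) < n := Nat.cast_pos.mpr (by omega)
    have hjR : (0 : ℝ) < (j : ℕ) := Nat.cast_pos.mpr (by omega)
    have hlt : ((j : ℕ) : ℝ) < n := Nat.cast_lt.mpr j.isLt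
    have hpos : 0 < Real.sin (Real.pi * (j : ℕ) / n) := by
      apply Real.sin_pos_of_pos_of_lt_pi (by positivity)
      rw [div_lt_iff₀ hnR]
      exact mul_lt_mul_of_pos_left hlt Real.pi_pos
    have hcast : Complex.sin z = (Real.sin (Real.pi * (j : ℕ) / n) : ℝ) := by
      rw [hz]
      push_cast
      rfl
    rw [hcast]
    exact Complex.ofReal_ne_zero.mpr hpos.ne'
  have hsq : (1 - ω) ^ 2 = -4 * Complex.sin z ^ 2 * ω := Complex.one_sub_exp_sq z
  have hω0 : ω ≠ 0 := Complex.exp_ne_zero _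
  have hωne (hj : (j : ℕ) ≠ 0) : ω ≠ 1 := by
    intro h
    rw [h] at hsq
    simp [hsin_ne hj] at hsq
  simp only [lam]
  split_ifs with h0 heven
  · have hω1 : ω = 1 := by simp [hωdef, hz, h0]
    rw [hω1, sum_range_min_mul_one_pow, h0, hn]
    simp
    ring
  · rw [sum_range_min_mul_pow_of_pow_eq_one (hωm.trans heven.neg_one_pow) (hωne h0)]
    ring
  · have hmain := one_sub_sq_mul_sum_range_min_mul_pow_of_pow_eq_neg_one
      (hωm.trans (Nat.not_even_iff_odd.mp heven).neg_one_pow)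
    have hsin := hsin_ne h0
    have hS : ∑ w ∈ Finset.range n, ((min w (n - w) : ℕ) : ℂ) * ω ^ w =
        -(1 / Complex.sin z) ^ 2 := by
      rw [hsq] at hmain
      field_simp
      apply mul_left_cancel₀ hω0
      linear_combination (-1 / 4) * hmain
    rw [hS]
    push_cast
    rw [hz]
    ring
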